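/- The transformed potential V₀(x) = 2·h₀(x)² − 2·μ₀² − V(x) is non-negative for all x ∈ ℝ, where h₀ = φ₀'/φ₀. In particular the transformed Schrödinger operator L₀ u = −u'' + V₀·u has non-negative quadratic form. -/

import Mathlib

open Real MeasureTheory Filter

noncomputable def Qs (x : ℝ) : ℝ := (3/2) * (1 / Real.cosh (x/2))^2
noncomputable def Hs (x : ℝ) : ℝ := Real.tanh (x/2)
noncomputable def alphaFn (x : ℝ) : ℝ := (1/3) * (Real.sinh x + x)
noncomputable def alphaInv : ℝ → ℝ := Function.invFun alphaFn
noncomputable def Qt (x : ℝ) : ℝ := Qs (alphaInv x)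
noncomputable def Ht (x : ℝ) : ℝ := Hs (alphaInv x)
noncomputable def Vpot (x : ℝ) : ℝ := 2 * (Qt x)^2 * (1 - Qt x)

theorem hasDerivAt_alphaFn (y : ℝ) : HasDerivAt alphaFn ((1/3) * (Real.cosh y + 1)) y :=
  ((Real.hasDerivAt_sinh y).add (hasDerivAt_id y)).const_mul (1/3)

theorem strictMono_alphaFn : StrictMono alphaFn := by
  intro a b hab
  have := Real.sinh_lt_sinh.2 hab
  unfold alphaFn
  linarith

theorem alphaFn_neg (y : ℝ) : alphaFn (-y) = -alphaFn y := by
  simp only [alphaFn, Real.sinh_neg]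
  ring

theorem continuous_alphaFn : Continuous alphaFn :=
  continuous_iff_continuousAt.2 fun y => (hasDerivAt_alphaFn y).continuousAt

theorem surjective_alphaFn : Function.Surjective alphaFn := by
  have key : Tendsto alphaFn atTop atTop := by
    refine tendsto_atTop_mono' atTop (f₁ := fun y : ℝ => (1/3) * y) ?_ ?_
    · filter_upwards [eventually_ge_atTop (0:ℝ)] with y hy
      have := Real.sinh_nonneg_iff.2 hy
      unfold alphaFn
      linarith
    · exact tendsto_id.const_mul_atTop (by norm_num)
  refine continuous_alphaFn.surjective key ?_
  have h : alphaFn = fun y => -alphaFn (-y) := by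
    ext y
    rw [alphaFn_neg, neg_neg]
  rw [h]
  exact tendsto_neg_atTop_atBot.comp (key.comp tendsto_neg_atBot_atTop)

theorem alphaFn_alphaInv (x : ℝ) : alphaFn (alphaInv x) = x :=
  Function.rightInverse_invFun surjective_alphaFn x

theorem alphaInv_alphaFn (y : ℝ) : alphaInv (alphaFn y) = y :=
  Function.leftInverse_invFun strictMono_alphaFn.injective y

theorem strictMono_alphaInv : StrictMono alphaInv := fun a b hab =>
  strictMono_alphaFn.lt_iff_lt.1 (by simpa only [alphaFn_alphaInv] using hab)

theorem continuous_alphaInv : Continuous alphaInv :=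
  strictMono_alphaInv.monotone.continuous_of_surjective fun y => ⟨alphaFn y, alphaInv_alphaFn y⟩

theorem alphaInv_neg (x : ℝ) : alphaInv (-x) = -alphaInv x :=
  strictMono_alphaFn.injective (by rw [alphaFn_neg, alphaFn_alphaInv, alphaFn_alphaInv])

theorem alphaInv_nonneg {x : ℝ} (hx : 0 ≤ x) : 0 ≤ alphaInv x := by
  have h0 : alphaInv 0 = 0 := by
    have := alphaInv_neg 0
    rw [neg_zero] at this
    linarith
  simpa only [h0] using strictMono_alphaInv.monotone hx

theorem hasDerivAt_alphaInv (x : ℝ) : HasDerivAt alphaInv (Qt x) x := by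
  have hc := Real.cosh_pos (alphaInv x)
  have h := HasDerivAt.of_local_left_inverse (f := alphaFn) continuous_alphaInv.continuousAt
    (hasDerivAt_alphaFn (alphaInv x)) (by positivity)
    (Eventually.of_forall alphaFn_alphaInv)
  refine h.congr_deriv ?_
  have h2 : Real.cosh (alphaInv x) + 1 = 2 * Real.cosh (alphaInv x / 2) ^ 2 := by
    have e : alphaInv x = 2 * (alphaInv x / 2) := by ring
    have h3 := Real.cosh_two_mul (alphaInv x / 2)
    rw [← e] at h3
    have := Real.cosh_sq (alphaInv x / 2)
    linarith
  have := Real.cosh_pos (alphaInv x / 2)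
  rw [h2, Qt, Qs]
  field_simp

theorem Hs_sq (y : ℝ) : Hs y ^ 2 = 1 - 2 / 3 * Qs y := by
  have h := Real.cosh_pos (y / 2)
  have h2 := Real.cosh_sq (y / 2)
  rw [Hs, Qs, Real.tanh_eq_sinh_div_cosh]
  field_simp
  linarith

theorem hasDerivAt_Qs (y : ℝ) : HasDerivAt Qs (-(Qs y * Hs y)) y := by
  have h := Real.cosh_pos (y / 2)
  have h1 : HasDerivAt (fun y : ℝ => Real.cosh (y / 2)) (Real.sinh (y / 2) * (1 / 2)) y :=
    ((hasDerivAt_id y).div_const 2).cosh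
  have h2 := (((hasDerivAt_const y (1:ℝ)).fun_div h1 h.ne').fun_pow 2).const_mul (3/2)
  refine h2.congr_deriv ?_
  rw [Hs, Qs, Real.tanh_eq_sinh_div_cosh, Nat.add_one_sub_one, pow_one, Nat.cast_ofNat]
  field_simp
  ring

theorem Qt_pos (x : ℝ) : 0 < Qt x := by
  have := Real.cosh_pos (alphaInv x / 2)
  unfold Qt Qs
  positivity

theorem Ht_sq (x : ℝ) : Ht x ^ 2 = 1 - 2 / 3 * Qt x := Hs_sq _

theorem Qt_le (x : ℝ) : Qt x ≤ 3 / 2 := by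
  nlinarith [Ht_sq x, sq_nonneg (Ht x)]

theorem Ht_nonneg {x : ℝ} (hx : 0 ≤ x) : 0 ≤ Ht x := by
  have := alphaInv_nonneg hx
  have h2 : 0 ≤ Real.sinh (alphaInv x / 2) := Real.sinh_nonneg_iff.2 (by linarith)
  have h3 := Real.cosh_pos (alphaInv x / 2)
  rw [Ht, Hs, Real.tanh_eq_sinh_div_cosh]
  positivity

theorem Qt_neg (x : ℝ) : Qt (-x) = Qt x := by
  rw [Qt, Qt, alphaInv_neg, Qs, Qs, neg_div, Real.cosh_neg]

theorem Vpot_neg (x : ℝ) : Vpot (-x) = Vpot x := by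
  rw [Vpot, Vpot, Qt_neg]

theorem hasDerivAt_Qt (x : ℝ) : HasDerivAt Qt (-(Qt x ^ 2 * Ht x)) x := by
  have h := (hasDerivAt_Qs (alphaInv x)).comp x (hasDerivAt_alphaInv x)
  refine h.congr_deriv ?_
  simp only [Qt, Ht]
  ring

theorem hasDerivAt_Vpot (x : ℝ) :
    HasDerivAt Vpot (2 * Qt x ^ 3 * Ht x * (3 * Qt x - 2)) x := by
  have h := (((hasDerivAt_Qt x).fun_pow 2).const_mul 2).fun_mul ((hasDerivAt_Qt x).const_sub 1)
  refine h.congr_deriv ?_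
  ring

theorem antitoneOn_Qt : AntitoneOn Qt (Set.Ici 0) := by
  refine antitoneOn_of_deriv_nonpos (convex_Ici 0)
    (fun x _ => (hasDerivAt_Qt x).continuousAt.continuousWithinAt)
    (fun x _ => (hasDerivAt_Qt x).differentiableAt.differentiableWithinAt) fun x hx => ?_
  rw [interior_Ici] at hx
  have := Ht_nonneg (Set.mem_Ioi.1 hx).le
  rw [(hasDerivAt_Qt x).deriv]
  nlinarith [mul_nonneg (sq_nonneg (Qt x)) this]

theorem exists_Qt_le_one : ∃ x : ℝ, 0 ≤ x ∧ Qt x ≤ 1 := by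
  refine ⟨alphaFn 2, ?_, ?_⟩
  · have : 0 ≤ Real.sinh 2 := Real.sinh_nonneg_iff.2 (by norm_num)
    unfold alphaFn
    linarith
  · have h1 : (1:ℝ) ≤ Real.sinh 1 := Real.self_le_sinh_iff.2 (by norm_num)
    have h2 := Real.cosh_sq 1
    have h3 := Real.cosh_pos 1
    rw [Qt, alphaInv_alphaFn, Qs, div_self (two_ne_zero), div_pow, one_pow, mul_one_div,
      div_le_one (by positivity)]
    nlinarith

theorem abs_Vpot_le (x : ℝ) : |Vpot x| ≤ 9 := by
  have h1 := Qt_pos x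
  have h2 := Qt_le x
  have h3 : Qt x ^ 2 ≤ 9 / 4 := by nlinarith
  rw [Vpot, abs_le]
  constructor <;> nlinarith [sq_nonneg (Qt x)]

theorem MonotoneOn.le_of_tendsto_atTop {f : ℝ → ℝ} {a l : ℝ} (hf : MonotoneOn f (Set.Ici a))
    (hl : Tendsto f atTop (nhds l)) : f a ≤ l :=
  ge_of_tendsto hl <| (eventually_ge_atTop a).mono fun _ hx => hf Set.self_mem_Ici hx hx

/-- The polynomial inequality showing that the energy is nonnegative at its critical points
with `Vpot < 0`. -/
theorem critical_point_inequality {q m : ℝ} (hq1 : 1 < q) (hq2 : q ≤ 3 / 2) (hm : m ≤ 0.78) :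
    4 * (q - 1) ^ 2 * (m - q ^ 2 * (q - 1)) ≤ q ^ 2 * (1 - 2 / 3 * q) * (3 * q - 2) ^ 2 := by
  obtain ⟨t, rfl⟩ : ∃ t, q = 1 + t := ⟨q - 1, by ring⟩
  have ht0 : 0 < t := by linarith
  have ht1 : t ≤ 1 / 2 := by linarith
  have hA : 4 * t ^ 2 * m ≤ 4 * t ^ 2 * 0.78 := by gcongr
  have h2 : t ^ 2 ≤ t * (1 / 2) := by nlinarith
  have h3 : t ^ 3 ≤ t * (1 / 4) := by nlinarith
  have hB : (1 + t) ^ 2 * (1 + t) ≤ (1 + t) ^ 2 * (1 + 4 * t - 3 * t ^ 2 - 6 * t ^ 3) := by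
    gcongr
    linarith
  have hC : 0 ≤ t ^ 3 := by positivity
  linarith

/-- The energy `φ'² - (μ² + V/2) φ²`, which is `φ²/2` times the transformed potential. -/
noncomputable def energy (φ : ℝ → ℝ) (μ x : ℝ) : ℝ :=
  deriv φ x ^ 2 - (μ ^ 2 + Vpot x / 2) * φ x ^ 2

section Eigenfunction

variable {φ : ℝ → ℝ} {μ : ℝ}

theorem hasDerivAt_deriv_eigenfunction (hC2 : ContDiff ℝ 2 φ)
    (heq : ∀ x : ℝ, -(deriv (deriv φ) x) + Vpot x * φ x = -μ^2 * φ x) (x : ℝ) :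
    HasDerivAt (deriv φ) ((Vpot x + μ ^ 2) * φ x) x := by
  have h : ContDiff ℝ 1 (deriv φ) :=
    (contDiff_succ_iff_deriv.1 (one_add_one_eq_two (R := WithTop ℕ∞) ▸ hC2)).2.2
  have h2 := (h.differentiable one_ne_zero x).hasDerivAt
  refine h2.congr_deriv ?_
  linarith [heq x]

theorem hasDerivAt_energy (hC2 : ContDiff ℝ 2 φ)
    (heq : ∀ x : ℝ, -(deriv (deriv φ) x) + Vpot x * φ x = -μ^2 * φ x) (x : ℝ) :
    HasDerivAt (energy φ μ) (φ x * (Vpot x * deriv φ x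
      - Qt x ^ 3 * Ht x * (3 * Qt x - 2) * φ x)) x := by
  have h1 := (hC2.differentiable two_ne_zero x).hasDerivAt
  have h2 := hasDerivAt_deriv_eigenfunction hC2 heq x
  have h := (h2.fun_pow 2).fun_sub
    ((((hasDerivAt_Vpot x).div_const 2).const_add (μ ^ 2)).fun_mul (h1.fun_pow 2))
  refine h.congr_deriv ?_
  push_cast
  ring

/-- Where the potential stays nonnegative, the eigenfunction decays at rate at least `μ`. -/
theorem deriv_add_mul_nonpos (hC2 : ContDiff ℝ 2 φ) (hpos : ∀ x : ℝ, 0 < φ x) (hμ : 0 < μ)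
    (heq : ∀ x : ℝ, -(deriv (deriv φ) x) + Vpot x * φ x = -μ^2 * φ x)
    (hφ : Tendsto φ atTop (nhds 0)) (hφ' : Tendsto (deriv φ) atTop (nhds 0))
    {a : ℝ} (ha : ∀ x, a ≤ x → 0 ≤ Vpot x) : deriv φ a + μ * φ a ≤ 0 := by
  have hd : ∀ x, HasDerivAt (fun x => Real.exp (-μ * x) * (deriv φ x + μ * φ x))
      (Real.exp (-μ * x) * (Vpot x * φ x)) x := by
    intro x
    have h1 := (hC2.differentiable two_ne_zero x).hasDerivAt
    have h2 := hasDerivAt_deriv_eigenfunction hC2 heq x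
    have h := (((hasDerivAt_id x).const_mul (-μ)).exp).fun_mul (h2.fun_add (h1.const_mul μ))
    refine h.congr_deriv ?_
    simp only [id]
    ring
  have hmono : MonotoneOn (fun x => Real.exp (-μ * x) * (deriv φ x + μ * φ x)) (Set.Ici a) := by
    refine monotoneOn_of_deriv_nonneg (convex_Ici a)
      (fun x _ => (hd x).continuousAt.continuousWithinAt)
      (fun x _ => (hd x).differentiableAt.differentiableWithinAt) fun x hx => ?_
    rw [interior_Ici] at hx
    rw [(hd x).deriv]
    exact mul_nonneg (Real.exp_pos _).le (mul_nonneg (ha x (Set.mem_Ioi.1 hx).le) (hpos x).le)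
  have hexp : Tendsto (fun x : ℝ => Real.exp (-μ * x)) atTop (nhds 0) :=
    Real.tendsto_exp_atBot.comp (tendsto_id.const_mul_atTop_of_neg (by linarith))
  have hlim := hexp.mul (hφ'.add (hφ.const_mul μ))
  simp only [mul_zero, add_zero] at hlim
  have h := hmono.le_of_tendsto_atTop hlim
  exact nonpos_of_mul_nonpos_right h (Real.exp_pos _)

theorem energy_nonneg_of_Qt_le_one (hC2 : ContDiff ℝ 2 φ) (hpos : ∀ x : ℝ, 0 < φ x)
    (hμ : 1 / 2 ≤ μ)
    (heq : ∀ x : ℝ, -(deriv (deriv φ) x) + Vpot x * φ x = -μ^2 * φ x)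
    (hφ : Tendsto φ atTop (nhds 0)) (hφ' : Tendsto (deriv φ) atTop (nhds 0))
    {a : ℝ} (ha : 0 ≤ a) (hq : Qt a ≤ 1) : 0 ≤ energy φ μ a := by
  have hQ : ∀ x, a ≤ x → Qt x ≤ 1 := fun x hx =>
    (antitoneOn_Qt ha (ha.trans hx) hx).trans hq
  have hV : ∀ x, a ≤ x → 0 ≤ Vpot x := fun x hx => by
    have := sub_nonneg.2 (hQ x hx)
    unfold Vpot
    positivity
  have hd := hasDerivAt_energy hC2 heq
  have hmono : MonotoneOn (fun x => -energy φ μ x) (Set.Ici a) := by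
    refine monotoneOn_of_deriv_nonneg (convex_Ici a)
      (fun x _ => (hd x).neg.continuousAt.continuousWithinAt)
      (fun x _ => (hd x).neg.differentiableAt.differentiableWithinAt) fun x hx => ?_
    rw [interior_Ici] at hx
    have hx : a ≤ x := (Set.mem_Ioi.1 hx).le
    have hdx := (hd x).neg.deriv
    rw [show (fun x => -energy φ μ x) = -energy φ μ from rfl, hdx]
    have h1 := deriv_add_mul_nonpos hC2 hpos (by linarith) heq hφ hφ'
      fun y hy => hV y (hx.trans hy)
    have hp := hpos x
    have h2 : Vpot x * deriv φ x ≤ Vpot x * (-(1 / 2) * φ x) :=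
      mul_le_mul_of_nonneg_left (by nlinarith) (hV x hx)
    have hH := Ht_nonneg (ha.trans hx)
    have hH1 : Ht x ≤ 1 := by nlinarith [Ht_sq x, Qt_pos x]
    have hq0 := Qt_pos x
    have hq1 := hQ x hx
    have h3 : 0 ≤ Vpot x * (1 / 2) + Qt x ^ 3 * Ht x * (3 * Qt x - 2) := by
      have h4 : 0 ≤ (1 - Qt x) + Qt x * Ht x * (3 * Qt x - 2) := by
        have h6 : 0 ≤ 1 - 3 * Qt x + 3 * Qt x ^ 2 := by nlinarith [sq_nonneg (2 * Qt x - 1)]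
        linarith [mul_nonneg (sub_nonneg.2 hH1) (sub_nonneg.2 hq1), mul_nonneg hH h6]
      have := mul_nonneg (sq_nonneg (Qt x)) h4
      unfold Vpot
      linarith
    have h5 := mul_nonneg h3 hp.le
    rw [← mul_neg]
    exact mul_nonneg hp.le (by linarith)
  have hlim : Tendsto (fun x => -energy φ μ x) atTop (nhds 0) := by
    have hVφ : Tendsto (fun x => Vpot x * φ x) atTop (nhds 0) := by
      refine squeeze_zero_norm (a := fun x => 9 * |φ x|) (fun x => ?_)
        (by simpa using hφ.abs.const_mul 9)
      rw [norm_mul, Real.norm_eq_abs, Real.norm_eq_abs]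
      exact mul_le_mul_of_nonneg_right (abs_Vpot_le x) (abs_nonneg _)
    have h := (((hφ'.pow 2).sub ((hφ.pow 2).const_mul (μ ^ 2))).sub
      ((hVφ.mul hφ).div_const 2)).neg
    convert h using 1
    · ext x
      unfold energy
      ring
    · norm_num
  linarith [hmono.le_of_tendsto_atTop hlim]

theorem energy_neg (heven : ∀ x : ℝ, φ (-x) = φ x) (x : ℝ) : energy φ μ (-x) = energy φ μ x := by
  have h : deriv φ (-x) = -deriv φ x := by
    have h2 := deriv_comp_neg φ x
    rw [funext heven] at h2
    linarith
  rw [energy, energy, h, heven, Vpot_neg, neg_sq]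

theorem energy_nonneg (hC2 : ContDiff ℝ 2 φ) (hpos : ∀ x : ℝ, 0 < φ x)
    (heven : ∀ x : ℝ, φ (-x) = φ x) (hμ1 : 1 / 2 ≤ μ) (hμ2 : μ ≤ 0.883)
    (heq : ∀ x : ℝ, -(deriv (deriv φ) x) + Vpot x * φ x = -μ^2 * φ x)
    (hφ : Tendsto φ atTop (nhds 0)) (hφ' : Tendsto (deriv φ) atTop (nhds 0))
    (x : ℝ) : 0 ≤ energy φ μ x := by
  have houter : ∀ y, Qt y ≤ 1 → 0 ≤ energy φ μ y := by
    intro y hy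
    rcases le_total 0 y with h | h
    · exact energy_nonneg_of_Qt_le_one hC2 hpos hμ1 heq hφ hφ' h hy
    · rw [← energy_neg heven]
      exact energy_nonneg_of_Qt_le_one hC2 hpos hμ1 heq hφ hφ' (neg_nonneg.2 h)
        (by rwa [Qt_neg])
  by_contra! hneg
  obtain ⟨b, hb0, hb⟩ := exists_Qt_le_one
  set X := max b |x|
  have hX0 : 0 ≤ X := hb0.trans (le_max_left _ _)
  have hX : Qt X ≤ 1 := (antitoneOn_Qt hb0 hX0 (le_max_left _ _)).trans hb
  have hd := hasDerivAt_energy hC2 heq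
  obtain ⟨z, hz, hmin⟩ := isCompact_Icc.exists_isMinOn (s := Set.Icc (-X) X)
    ⟨0, by constructor <;> linarith⟩ (f := energy φ μ)
    fun y _ => (hd y).continuousAt.continuousWithinAt
  have hzneg : energy φ μ z < 0 :=
    (hmin (abs_le.1 (le_max_right b |x|))).trans_lt hneg
  have hz1 : -X ≠ z := by
    rintro rfl
    exact hzneg.not_ge (houter _ (by rwa [Qt_neg]))
  have hz2 : z ≠ X := by
    rintro rfl
    exact hzneg.not_ge (houter _ hX)
  have hq1 : 1 < Qt z := lt_of_not_ge fun h => hzneg.not_ge (houter z h)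
  have hcrit := (hmin.isLocalMin
    (Icc_mem_nhds (lt_of_le_of_ne hz.1 hz1) (lt_of_le_of_ne hz.2 hz2))).hasDerivAt_eq_zero (hd z)
  have hp := hpos z
  have hcrit' : Vpot z * deriv φ z = Qt z ^ 3 * Ht z * (3 * Qt z - 2) * φ z := by
    have := (mul_eq_zero.1 hcrit).resolve_left hp.ne'
    linarith
  have hpoly := critical_point_inequality hq1 (Qt_le z) (m := μ ^ 2) (by nlinarith)
  have hsq : 4 * (Qt z - 1) ^ 2 * deriv φ z ^ 2 =
      Qt z ^ 2 * (1 - 2 / 3 * Qt z) * (3 * Qt z - 2) ^ 2 * φ z ^ 2 := by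
    have hq4 : Qt z ^ 4 ≠ 0 := (pow_pos (Qt_pos z) 4).ne'
    refine mul_left_cancel₀ hq4 ?_
    have h := congrArg (fun t => t ^ 2) hcrit'
    simp only [Vpot] at h
    rw [← Ht_sq]
    linear_combination h
  have hpoly' := mul_le_mul_of_nonneg_right hpoly (sq_nonneg (φ z))
  have hpr : 0 ≤ 4 * (Qt z - 1) ^ 2 * energy φ μ z := by
    rw [energy, Vpot]
    linarith
  have : 0 < 4 * (Qt z - 1) ^ 2 := by
    have := sub_pos.2 hq1
    positivity
  exact hzneg.not_ge (nonneg_of_mul_nonneg_right hpr this)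

end Eigenfunction

/-- The transformed potential `V₀ = 2h₀² − 2μ₀² − V` is
non-negative, hence the transformed operator `L₀` has non-negative quadratic
form. -/
theorem transformed_potential_nonneg (φ₀ : ℝ → ℝ) (μ₀ : ℝ)
    (hC2 : ContDiff ℝ 2 φ₀) (hpos : ∀ x : ℝ, 0 < φ₀ x)
    (heven : ∀ x : ℝ, φ₀ (-x) = φ₀ x)
    (hL2 : Integrable (fun x => (φ₀ x)^2))
    (hμ1 : (0.808:ℝ) ≤ μ₀) (hμ2 : μ₀ ≤ (0.883:ℝ))
    (heq : ∀ x : ℝ, -(deriv (deriv φ₀) x) + Vpot x * φ₀ x = -μ₀^2 * φ₀ x)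
    (hdecay : ∃ C > (0:ℝ), ∀ x : ℝ,
      |φ₀ x| + |deriv φ₀ x| ≤ C * Real.exp (-(Real.sqrt 2 / 2) * μ₀ * |x|)) :
    (∀ x : ℝ, 0 ≤ 2 * (deriv φ₀ x / φ₀ x)^2 - 2 * μ₀^2 - Vpot x) ∧
    (∀ u : ℝ → ℝ, Differentiable ℝ u → Integrable (fun x => (u x)^2) →
      Integrable (fun x => (deriv u x)^2) →
      0 ≤ ∫ x, ((deriv u x)^2
          + (2 * (deriv φ₀ x / φ₀ x)^2 - 2 * μ₀^2 - Vpot x) * (u x)^2)) := by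
  obtain ⟨C, -, hC⟩ := hdecay
  have hc : -(Real.sqrt 2 / 2) * μ₀ < 0 := by
    have : 0 < Real.sqrt 2 := by positivity
    nlinarith
  have hexp : Tendsto (fun x : ℝ => C * Real.exp (-(Real.sqrt 2 / 2) * μ₀ * |x|)) atTop
      (nhds 0) := by
    have h := (Real.tendsto_exp_atBot.comp
      (tendsto_abs_atTop_atTop.const_mul_atTop_of_neg hc)).const_mul C
    rwa [mul_zero] at h
  have hφ : Tendsto φ₀ atTop (nhds 0) := squeeze_zero_norm
    (fun x => (le_add_of_nonneg_right (abs_nonneg (deriv φ₀ x))).trans (hC x)) hexp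
  have hφ' : Tendsto (deriv φ₀) atTop (nhds 0) := squeeze_zero_norm
    (fun x => (le_add_of_nonneg_left (abs_nonneg (φ₀ x))).trans (hC x)) hexp
  have hV : ∀ x : ℝ, 0 ≤ 2 * (deriv φ₀ x / φ₀ x)^2 - 2 * μ₀^2 - Vpot x := by
    intro x
    have hE := energy_nonneg hC2 hpos heven (by linarith) hμ2 heq hφ hφ' x
    have hp := hpos x
    have h : 2 * (deriv φ₀ x / φ₀ x)^2 - 2 * μ₀^2 - Vpot x
        = 2 * energy φ₀ μ₀ x / φ₀ x ^ 2 := by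
      unfold energy
      field_simp
      ring
    rw [h]
    positivity
  exact ⟨hV, fun u _ _ _ => integral_nonneg fun x =>
    add_nonneg (sq_nonneg _) (mul_nonneg (hV x) (sq_nonneg _))⟩
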